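/- Let n ≥ 1 and let m ≥ 0 be an even integer. Let f : H⁺ → Cl_n be smooth such that Δ(Pf) + (m/x_n) ∂(Pf)/∂x_n = 0 and Δ(Qf) + (m/x_n) ∂(Qf)/∂x_n = (m/x_n²) Qf on H⁺ (this is the Weinstein system characterizing Δ^{(k+2)/2} f = 0 with parameter k = −m). Then g(x) := x_n^m f(x) satisfies Δ^{(m+2)/2} g = 0 on H⁺. -/

import Mathlib

noncomputable section

open scoped symmDiff

/-- An explicit model of the real Clifford algebra `Cl_n` with generators `e 0, …, e (n-1)`
satisfying `eᵢ eⱼ + eⱼ eᵢ = -2 δᵢⱼ` (the Clifford algebra of the negative definite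
quadratic form on `ℝⁿ`): elements are coordinate functions on the canonical basis
`(e_A)_{A ⊆ {0,…,n-1}}`, where `e_A` is the (increasingly ordered) product of the `e i`, `i ∈ A`. -/
def Cl (n : ℕ) : Type := Finset (Fin n) → ℝ

namespace Cl

variable {n : ℕ}

instance : NormedAddCommGroup (Cl n) :=
  inferInstanceAs (NormedAddCommGroup (Finset (Fin n) → ℝ))

instance : NormedSpace ℝ (Cl n) :=
  inferInstanceAs (NormedSpace ℝ (Finset (Fin n) → ℝ))

/-- The coefficient of `a` at the basis element `e_A`. -/
def coeff (a : Cl n) (A : Finset (Fin n)) : ℝ := a A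

/-- The sign occurring in the product `e_A * e_B = mulSign A B • e_{A ∆ B}`,
coming from the relations `eᵢ eⱼ = -eⱼ eᵢ` (i ≠ j) and `eᵢ² = -1`. -/
def mulSign (A B : Finset (Fin n)) : ℝ :=
  (-1 : ℝ) ^ (((A ×ˢ B).filter fun p => p.2 < p.1).card + (A ∩ B).card)

/-- Clifford multiplication. -/
def mul (a b : Cl n) : Cl n := fun C =>
  ∑ A : Finset (Fin n), ∑ B : Finset (Fin n),
    if A ∆ B = C then mulSign A B * a A * b B else 0

/-- The unit `1` of the Clifford algebra. -/
def one : Cl n := Pi.single ∅ 1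

/-- The embedding of the real scalars. -/
def scalar (r : ℝ) : Cl n := Pi.single ∅ r

/-- The generators `e i` (in the paper: `e_1, …, e_n`). -/
def e (i : Fin n) : Cl n := Pi.single {i} 1

/-- Reversion: the anti-automorphism fixing all the `e i`. -/
def reverse (a : Cl n) : Cl n := fun A => (-1 : ℝ) ^ (A.card * (A.card - 1) / 2) * a A

/-- The main involution `′`: the automorphism with `(e i)′ = - e i`. -/
def involute (a : Cl n) : Cl n := fun A => (-1 : ℝ) ^ A.card * a A

/-- Clifford conjugation: the anti-automorphism with `conj (e i) = - e i`
(the composite of reversion and the main involution). -/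
def conj (a : Cl n) : Cl n := fun A => (-1 : ℝ) ^ (A.card * (A.card + 1) / 2) * a A

/-- The norm on `Cl n`: the square root of the sum of the squares of the
coordinates in the standard basis. -/
def norm (a : Cl n) : ℝ := Real.sqrt (∑ A : Finset (Fin n), a A ^ 2)

/-- Invertibility in the Clifford algebra. -/
def IsInvertible (a : Cl n) : Prop := ∃ b, mul a b = one ∧ mul b a = one

/-- The inverse of an invertible Clifford number (junk value `0` otherwise). -/
def inv (a : Cl n) : Cl n :=
  letI := Classical.propDecidable (IsInvertible a)
  if h : IsInvertible a then h.choose else 0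

/-- The paravector `x₀ + x₁ e₁ + ⋯ + xₙ eₙ` attached to `x ∈ ℝ^{n+1}`. -/
def para (x : Fin (n + 1) → ℝ) : Cl n :=
  scalar (x 0) + ∑ i : Fin n, x i.succ • e i

/-- Being a paravector. -/
def IsParavector (a : Cl n) : Prop := ∃ x : Fin (n + 1) → ℝ, a = para x

/-- The coordinates in `ℝ^{n+1}` of (the paravector part of) a Clifford number. -/
def paraCoord (a : Cl n) : Fin (n + 1) → ℝ :=
  Fin.cases (coeff a ∅) (fun i => coeff a {i})

/-- Being a (possibly empty) product of nonzero paravectors. -/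
def IsProdOfParavectors (a : Cl n) : Prop :=
  ∃ l : List (Fin (n + 1) → ℝ), (∀ x ∈ l, x ≠ 0) ∧
    a = l.foldr (fun x b => mul (para x) b) one

/-- The special Ahlfors–Vahlen group `SAV(ℝ ⊕ ℝⁿ)`: 2×2 matrices `(a b; c d)` with entries
in `Cl n` such that each entry is `0` or a product of nonzero paravectors,
`a ⬝ reverse d - b ⬝ reverse c = 1`, and `a c⁻¹, c⁻¹ d` are paravectors if `c ≠ 0`
resp. `b d⁻¹` is a paravector if `c = 0`. -/
structure SAV (n : ℕ) where
  a : Cl n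
  b : Cl n
  c : Cl n
  d : Cl n
  prod_a : a = 0 ∨ IsProdOfParavectors a
  prod_b : b = 0 ∨ IsProdOfParavectors b
  prod_c : c = 0 ∨ IsProdOfParavectors c
  prod_d : d = 0 ∨ IsProdOfParavectors d
  det : mul a (reverse d) - mul b (reverse c) = one
  cond_c : c ≠ 0 → IsParavector (mul a (inv c)) ∧ IsParavector (mul (inv c) d)
  cond_c0 : c = 0 → IsParavector (mul b (inv d))

/-- The Clifford number `c x + d` attached to a matrix `M` and `x ∈ ℝ^{n+1}`. -/
def cxd (M : SAV n) (x : Fin (n + 1) → ℝ) : Cl n := mul M.c (para x) + M.d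

/-- The numerator `a x + b`. -/
def axb (M : SAV n) (x : Fin (n + 1) → ℝ) : Cl n := mul M.a (para x) + M.b

/-- The Möbius transformation `M<x> = (ax+b)(cx+d)⁻¹` as a Clifford number. -/
def moebiusCl (M : SAV n) (x : Fin (n + 1) → ℝ) : Cl n := mul (axb M x) (inv (cxd M x))

/-- The Möbius transformation `M<x>` as a point of `ℝ^{n+1}`. -/
def moebius (M : SAV n) (x : Fin (n + 1) → ℝ) : Fin (n + 1) → ℝ :=
  paraCoord (moebiusCl M x)

/-- `a` lies in the subalgebra `Cl_{n-1}` generated by the `e j` with `j ≠ i`. -/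
def memSub (a : Cl n) (i : Fin n) : Prop := ∀ A : Finset (Fin n), i ∈ A → coeff a A = 0

/-- The subgroup `SAV(ℝ ⊕ ℝ^{m})` of `SAV(ℝ ⊕ ℝ^{m+1})` of matrices whose entries lie
in the subalgebra `Cl_m ⊆ Cl_{m+1}`. -/
structure SAVsub (m : ℕ) extends SAV (m + 1) where
  sub_a : memSub a (Fin.last m)
  sub_b : memSub b (Fin.last m)
  sub_c : memSub c (Fin.last m)
  sub_d : memSub d (Fin.last m)

/-- The `P`-part of `a ∈ Cl_{m+1} = Cl_m ⊕ Cl_m e_{top}`: `a = P a + (Q a) e_top`. -/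
def Ppart {m : ℕ} (a : Cl (m + 1)) : Cl (m + 1) := fun A =>
  if Fin.last m ∈ A then 0 else a A

/-- The `Q`-part of `a ∈ Cl_{m+1} = Cl_m ⊕ Cl_m e_{top}`: `a = P a + (Q a) e_top`. -/
def Qpart {m : ℕ} (a : Cl (m + 1)) : Cl (m + 1) := fun A =>
  if Fin.last m ∈ A then 0 else a (insert (Fin.last m) A)

/-- Partial derivative `∂f/∂xᵢ`. -/
def pderiv {E : Type*} [NormedAddCommGroup E] [NormedSpace ℝ E] {m : ℕ}
    (i : Fin m) (f : (Fin m → ℝ) → E) (x : Fin m → ℝ) : E :=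
  fderiv ℝ f x (Pi.single i 1)

/-- The Euclidean Laplacian `Δ = Σᵢ ∂²/∂xᵢ²` (acting componentwise). -/
def lap {E : Type*} [NormedAddCommGroup E] [NormedSpace ℝ E] {m : ℕ}
    (f : (Fin m → ℝ) → E) : (Fin m → ℝ) → E :=
  fun x => ∑ i : Fin m, pderiv i (pderiv i f) x

/-- The Euclidean Dirac operator `D f = ∂f/∂x₀ + Σᵢ eᵢ ∂f/∂xᵢ`. -/
def dirac (f : (Fin (n + 1) → ℝ) → Cl n) : (Fin (n + 1) → ℝ) → Cl n :=
  fun x => pderiv 0 f x + ∑ i : Fin n, mul (e i) (pderiv i.succ f x)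

/-- Upper half-space `H⁺ = {x ∈ ℝ^{n+1} : xₙ > 0}`. -/
def upperHalf (n : ℕ) : Set (Fin (n + 1) → ℝ) := {x | 0 < x (Fin.last n)}

/-- The Euclidean norm on `ℝ^m`. -/
def enorm {m : ℕ} (x : Fin m → ℝ) : ℝ := Real.sqrt (∑ i, x i ^ 2)

end Cl

namespace Cl

section Calculus

variable {E F : Type*} [NormedAddCommGroup E] [NormedSpace ℝ E]
  [NormedAddCommGroup F] [NormedSpace ℝ F] {N : ℕ} {U : Set (Fin N → ℝ)}

lemma pderiv_congr (hU : IsOpen U) {f g : (Fin N → ℝ) → E} (h : Set.EqOn f g U) (i : Fin N) :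
    Set.EqOn (pderiv i f) (pderiv i g) U := fun x hx => by
  rw [pderiv, pderiv, (h.eventuallyEq_of_mem (hU.mem_nhds hx)).fderiv_eq]

lemma lap_congr (hU : IsOpen U) {f g : (Fin N → ℝ) → E} (h : Set.EqOn f g U) :
    Set.EqOn (lap f) (lap g) U := fun _ hx =>
  Finset.sum_congr rfl fun i _ => pderiv_congr hU (pderiv_congr hU h i) i hx

lemma iterate_lap_congr (hU : IsOpen U) {f g : (Fin N → ℝ) → E} (h : Set.EqOn f g U) (k : ℕ) :
    Set.EqOn (lap^[k] f) (lap^[k] g) U := by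
  induction k generalizing f g with
  | zero => exact h
  | succ k ih => exact ih (lap_congr hU h)

lemma _root_.ContDiffOn.pderiv (hU : IsOpen U) {f : (Fin N → ℝ) → E}
    (hf : ContDiffOn ℝ (⊤ : ℕ∞) f U) (i : Fin N) :
    ContDiffOn ℝ (⊤ : ℕ∞) (pderiv i f) U :=
  (hf.fderiv_of_isOpen (m := (⊤ : ℕ∞)) hU (by norm_cast)).clm_apply contDiffOn_const

lemma _root_.ContDiffOn.lap (hU : IsOpen U) {f : (Fin N → ℝ) → E}
    (hf : ContDiffOn ℝ (⊤ : ℕ∞) f U) : ContDiffOn ℝ (⊤ : ℕ∞) (lap f) U :=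
  ContDiffOn.sum fun i _ => (hf.pderiv hU i).pderiv hU i

lemma differentiableAt_of_contDiffOn (hU : IsOpen U) {f : (Fin N → ℝ) → E}
    (hf : ContDiffOn ℝ (⊤ : ℕ∞) f U) {x : Fin N → ℝ} (hx : x ∈ U) : DifferentiableAt ℝ f x :=
  (hf.contDiffAt (hU.mem_nhds hx)).differentiableAt (by simp)

lemma pderiv_clm_comp (hU : IsOpen U) {f : (Fin N → ℝ) → E} (hf : ContDiffOn ℝ (⊤ : ℕ∞) f U)
    (φ : E →L[ℝ] F) (i : Fin N) :
    Set.EqOn (pderiv i fun y => φ (f y)) (fun y => φ (pderiv i f y)) U := fun x hx => by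
  have := φ.hasFDerivAt.comp x (differentiableAt_of_contDiffOn hU hf hx).hasFDerivAt
  simp only [pderiv]
  rw [show (fun y => φ (f y)) = φ ∘ f from rfl, this.fderiv]
  rfl

lemma lap_clm_comp (hU : IsOpen U) {f : (Fin N → ℝ) → E} (hf : ContDiffOn ℝ (⊤ : ℕ∞) f U)
    (φ : E →L[ℝ] F) : Set.EqOn (lap fun y => φ (f y)) (fun y => φ (lap f y)) U := fun x hx => by
  simp only [lap, map_sum]
  refine Finset.sum_congr rfl fun i _ => ?_
  rw [pderiv_congr hU (pderiv_clm_comp hU hf φ i) i hx,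
    pderiv_clm_comp hU (hf.pderiv hU i) φ i hx]

lemma iterate_lap_clm_comp (hU : IsOpen U) {f : (Fin N → ℝ) → E}
    (hf : ContDiffOn ℝ (⊤ : ℕ∞) f U) (φ : E →L[ℝ] F) (k : ℕ) :
    Set.EqOn (lap^[k] fun y => φ (f y)) (fun y => φ (lap^[k] f y)) U := by
  induction k generalizing f with
  | zero => exact fun _ _ => rfl
  | succ k ih =>
    exact (iterate_lap_congr hU (lap_clm_comp hU hf φ) k).trans (ih (hf.lap hU))

lemma pderiv_add (hU : IsOpen U) {f g : (Fin N → ℝ) → E} (hf : ContDiffOn ℝ (⊤ : ℕ∞) f U)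
    (hg : ContDiffOn ℝ (⊤ : ℕ∞) g U) (i : Fin N) :
    Set.EqOn (pderiv i fun y => f y + g y) (fun y => pderiv i f y + pderiv i g y) U :=
  fun x hx => by
    simp only [pderiv]
    rw [fderiv_fun_add (differentiableAt_of_contDiffOn hU hf hx)
      (differentiableAt_of_contDiffOn hU hg hx)]
    rfl

lemma lap_add (hU : IsOpen U) {f g : (Fin N → ℝ) → E} (hf : ContDiffOn ℝ (⊤ : ℕ∞) f U)
    (hg : ContDiffOn ℝ (⊤ : ℕ∞) g U) :
    Set.EqOn (lap fun y => f y + g y) (fun y => lap f y + lap g y) U := fun x hx => by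
  simp only [lap, ← Finset.sum_add_distrib]
  refine Finset.sum_congr rfl fun i _ => ?_
  rw [pderiv_congr hU (pderiv_add hU hf hg i) i hx,
    pderiv_add hU (hf.pderiv hU i) (hg.pderiv hU i) i hx]

lemma pderiv_const_mul (hU : IsOpen U) {f : (Fin N → ℝ) → ℝ} (hf : ContDiffOn ℝ (⊤ : ℕ∞) f U)
    (c : ℝ) (i : Fin N) :
    Set.EqOn (pderiv i fun y => c * f y) (fun y => c * pderiv i f y) U :=
  pderiv_clm_comp hU hf (c • ContinuousLinearMap.id ℝ ℝ) i

lemma lap_const_mul (hU : IsOpen U) {f : (Fin N → ℝ) → ℝ} (hf : ContDiffOn ℝ (⊤ : ℕ∞) f U)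
    (c : ℝ) : Set.EqOn (lap fun y => c * f y) (fun y => c * lap f y) U :=
  lap_clm_comp hU hf (c • ContinuousLinearMap.id ℝ ℝ)

lemma pderiv_comm (hU : IsOpen U) {f : (Fin N → ℝ) → E} (hf : ContDiffOn ℝ (⊤ : ℕ∞) f U)
    (i j : Fin N) : Set.EqOn (pderiv i (pderiv j f)) (pderiv j (pderiv i f)) U := fun x hx => by
  have h1 : DifferentiableAt ℝ (fderiv ℝ f) x :=
    differentiableAt_of_contDiffOn hU
      (hf.fderiv_of_isOpen (m := (⊤ : ℕ∞)) hU (by norm_cast)) hx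
  have key (i j : Fin N) : pderiv i (pderiv j f) x =
      fderiv ℝ (fderiv ℝ f) x (Pi.single i 1) (Pi.single j 1) := by
    have := (h1.hasFDerivAt.clm_apply (hasFDerivAt_const (Pi.single j (1 : ℝ)) x)).fderiv
    change fderiv ℝ (fun y => fderiv ℝ f y (Pi.single j 1)) x (Pi.single i 1) = _
    rw [this]
    simp
  rw [key, key]
  exact (hf.contDiffAt (hU.mem_nhds hx)).isSymmSndFDerivAt
    (by rw [minSmoothness_of_isRCLikeNormedField]; exact WithTop.coe_le_coe.2 le_top) _ _

lemma lap_pderiv (hU : IsOpen U) {f : (Fin N → ℝ) → E} (hf : ContDiffOn ℝ (⊤ : ℕ∞) f U)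
    (i : Fin N) : Set.EqOn (lap (pderiv i f)) (pderiv i (lap f)) U := fun x hx => by
  have hsum : pderiv i (lap f) x = ∑ j, pderiv i (pderiv j (pderiv j f)) x := by
    change fderiv ℝ (fun y => ∑ j, pderiv j (pderiv j f) y) x (Pi.single i 1) = _
    rw [fderiv_fun_sum fun j _ =>
      differentiableAt_of_contDiffOn hU ((hf.pderiv hU j).pderiv hU j) hx]
    simp [pderiv]
  rw [hsum]
  refine Finset.sum_congr rfl fun j _ => ?_
  rw [pderiv_congr hU (pderiv_comm hU hf j i) j hx, pderiv_comm hU (hf.pderiv hU j) j i hx]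

lemma contDiffOn_coord (i : Fin N) : ContDiffOn ℝ (⊤ : ℕ∞) (fun y : Fin N → ℝ => y i) U :=
  (contDiff_apply ℝ ℝ i).contDiffOn

lemma pderiv_coord_mul (hU : IsOpen U) {f : (Fin N → ℝ) → ℝ} (hf : ContDiffOn ℝ (⊤ : ℕ∞) f U)
    (i j : Fin N) : Set.EqOn (pderiv j fun y => y i * f y)
      (fun y => (Pi.single j 1 : Fin N → ℝ) i * f y + y i * pderiv j f y) U := fun x hx => by
  have h := ((hasFDerivAt_apply (𝕜 := ℝ) i x).mul
    (differentiableAt_of_contDiffOn hU hf hx).hasFDerivAt).fderiv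
  change fderiv ℝ ((fun y : Fin N → ℝ => y i) * f) x (Pi.single j 1) = _
  rw [h]
  simp [pderiv]
  ring

lemma pderiv_coord_mul_self (hU : IsOpen U) {f : (Fin N → ℝ) → ℝ}
    (hf : ContDiffOn ℝ (⊤ : ℕ∞) f U) (i : Fin N) :
    Set.EqOn (pderiv i fun y => y i * f y) (fun y => f y + y i * pderiv i f y) U :=
  fun x hx => by simp [pderiv_coord_mul hU hf i i hx]

lemma lap_coord_mul (hU : IsOpen U) {f : (Fin N → ℝ) → ℝ} (hf : ContDiffOn ℝ (⊤ : ℕ∞) f U)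
    (i : Fin N) : Set.EqOn (lap fun y => y i * f y)
      (fun y => 2 * pderiv i f y + y i * lap f y) U := fun x hx => by
  have key (j : Fin N) : pderiv j (pderiv j fun y => y i * f y) x =
      2 * ((Pi.single j 1 : Fin N → ℝ) i * pderiv j f x) + x i * pderiv j (pderiv j f) x := by
    rw [pderiv_congr hU (pderiv_coord_mul hU hf i j) j hx,
      pderiv_add hU (contDiffOn_const.mul hf) ((contDiffOn_coord i).mul (hf.pderiv hU j)) j hx]
    beta_reduce
    rw [pderiv_const_mul hU hf _ j hx, pderiv_coord_mul hU (hf.pderiv hU j) i j hx]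
    ring
  simp only [lap, key, Finset.sum_add_distrib, ← Finset.mul_sum]
  simp [Pi.single_apply]

lemma coord_mul_pderiv_coord_pow_mul (hU : IsOpen U) {f : (Fin N → ℝ) → ℝ}
    (hf : ContDiffOn ℝ (⊤ : ℕ∞) f U) (i : Fin N) (k : ℕ) {x : Fin N → ℝ} (hx : x ∈ U) :
    x i * pderiv i (fun y => y i ^ k * f y) x = x i ^ k * (k * f x + x i * pderiv i f x) := by
  induction k with
  | zero => simp
  | succ k ih =>
    simp only [pow_succ', mul_assoc]
    rw [pderiv_coord_mul_self hU (((contDiffOn_coord i).pow k).mul hf) i hx]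
    push_cast
    linear_combination x i * ih

lemma coord_sq_mul_lap_coord_pow_mul (hU : IsOpen U) {f : (Fin N → ℝ) → ℝ}
    (hf : ContDiffOn ℝ (⊤ : ℕ∞) f U) (i : Fin N) (k : ℕ) {x : Fin N → ℝ} (hx : x ∈ U) :
    x i ^ 2 * lap (fun y => y i ^ k * f y) x =
      x i ^ k * (x i ^ 2 * lap f x + 2 * k * x i * pderiv i f x + k * (k - 1) * f x) := by
  induction k with
  | zero => simp
  | succ k ih =>
    have h := coord_mul_pderiv_coord_pow_mul hU hf i k hx
    simp only [pow_succ' _ k, mul_assoc]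
    rw [lap_coord_mul hU (((contDiffOn_coord i).pow k).mul hf) i hx]
    push_cast
    linear_combination x i * ih + 2 * x i * h

/-- If `u` solves `t² Δu + 2p t ∂ₜu = 2pc u` with `c ∈ {0, 1}`, where `t = xᵢ ≠ 0`, then
`t^(2p) u` is polyharmonic of order `p + 1`. -/
lemma iterate_lap_coord_pow_mul_eq_zero (hU : IsOpen U) (i : Fin N) (hi : ∀ x ∈ U, x i ≠ 0)
    {c : ℝ} (hc : c * c = c) (p : ℕ) {u : (Fin N → ℝ) → ℝ} (hu : ContDiffOn ℝ (⊤ : ℕ∞) u U)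
    (h : ∀ x ∈ U, x i ^ 2 * lap u x + 2 * p * (x i * pderiv i u x) = 2 * p * c * u x) :
    ∀ x ∈ U, lap^[p + 1] (fun y => y i ^ (2 * p) * u y) x = 0 := by
  induction p generalizing u with
  | zero =>
    intro x hx
    have := h x hx
    simp only [Nat.cast_zero, mul_zero, zero_mul, add_zero, mul_eq_zero] at this
    simpa using this.resolve_left (pow_ne_zero 2 (hi x hx))
  | succ p ih =>
    push_cast at h
    have hut := hu.pderiv hU i
    have htu : ContDiffOn ℝ (⊤ : ℕ∞) (fun y => y i * pderiv i u y) U :=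
      (contDiffOn_coord i).mul hut
    have hcu : ContDiffOn ℝ (⊤ : ℕ∞) (fun y => (2 * p + 1 + c) * u y) U := contDiffOn_const.mul hu
    have hw := htu.add hcu
    set w : (Fin N → ℝ) → ℝ := fun y => y i * pderiv i u y + (2 * p + 1 + c) * u y with hwdef
    have hstep : Set.EqOn (lap fun y => y i ^ (2 * (p + 1)) * u y)
        (fun y => y i ^ (2 * p) * ((2 * (p + 1)) * w y)) U := fun x hx => by
      have h1 := coord_sq_mul_lap_coord_pow_mul hU hu i (2 * (p + 1)) hx
      refine mul_left_cancel₀ (pow_ne_zero 2 (hi x hx)) (h1.trans ?_)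
      simp only [hwdef]
      push_cast
      linear_combination x i ^ (2 * (p + 1)) * h x hx
    intro x hx
    rw [Function.iterate_succ_apply, iterate_lap_congr hU hstep (p + 1) hx]
    refine ih (contDiffOn_const.mul hw) (fun x hx => ?_) x hx
    have hLu := hu.lap hU
    have hd : pderiv i (fun y => y i * (y i * lap u y) + 2 * (p + 1) * (y i * pderiv i u y)) x =
        2 * (p + 1) * c * pderiv i u x := by
      refine Eq.trans ?_ (pderiv_const_mul hU hu _ i hx)
      refine pderiv_congr hU (fun y hy => ?_) i hx
      linear_combination h y hy
    rw [pderiv_add hU ((contDiffOn_coord i).mul ((contDiffOn_coord i).mul hLu))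
      (contDiffOn_const.mul htu) i hx] at hd
    beta_reduce at hd
    rw [pderiv_coord_mul_self hU ((contDiffOn_coord i).mul hLu) i hx,
      pderiv_const_mul hU htu _ i hx] at hd
    beta_reduce at hd
    rw [pderiv_coord_mul_self hU hLu i hx, pderiv_coord_mul_self hU hut i hx] at hd
    rw [lap_const_mul hU hw _ hx, pderiv_const_mul hU hw _ i hx]
    beta_reduce
    rw [lap_add hU htu hcu hx, pderiv_add hU htu hcu i hx]
    beta_reduce
    rw [lap_coord_mul hU hut i hx, lap_const_mul hU hu _ hx, pderiv_coord_mul_self hU hut i hx,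
      pderiv_const_mul hU hu _ i hx]
    beta_reduce
    rw [lap_pderiv hU hu i hx]
    simp only [hwdef]
    linear_combination (2 * (p + 1)) * (x i * hd + (2 * p - 1 + c) * h x hx + 2 * u x * hc)

end Calculus

instance (n : ℕ) : FiniteDimensional ℝ (Cl n) :=
  inferInstanceAs (FiniteDimensional ℝ (Finset (Fin n) → ℝ))

/-- The coefficient functional `a ↦ coeff a A`, as a continuous linear map. -/
def coeffCLM {n : ℕ} (A : Finset (Fin n)) : Cl n →L[ℝ] ℝ :=
  LinearMap.toContinuousLinearMap
    { toFun := fun a => coeff a A, map_add' := fun _ _ => rfl, map_smul' := fun _ _ => rfl }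

/-- The map `Ppart`, as a continuous linear map. -/
def PpartCLM (n : ℕ) : Cl (n + 1) →L[ℝ] Cl (n + 1) :=
  LinearMap.toContinuousLinearMap
    { toFun := Ppart
      map_add' := fun a b => funext fun A => by
        change ite _ _ (a A + b A) = ite _ _ _ + ite _ _ _
        split_ifs <;> simp
      map_smul' := fun r a => funext fun A => by
        change ite _ _ (r * a A) = r * ite _ _ _
        split_ifs <;> simp }

/-- The map `Qpart`, as a continuous linear map. -/
def QpartCLM (n : ℕ) : Cl (n + 1) →L[ℝ] Cl (n + 1) :=
  LinearMap.toContinuousLinearMap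
    { toFun := Qpart
      map_add' := fun a b => funext fun A => by
        change ite _ _ (a _ + b _) = ite _ _ _ + ite _ _ _
        split_ifs <;> simp
      map_smul' := fun r a => funext fun A => by
        change ite _ _ (r * a _) = r * ite _ _ _
        split_ifs <;> simp }

lemma coeff_Ppart {n : ℕ} (a : Cl (n + 1)) {A : Finset (Fin (n + 1))} (hA : Fin.last n ∉ A) :
    coeff (Ppart a) A = coeff a A := if_neg hA

lemma coeff_Qpart_erase {n : ℕ} (a : Cl (n + 1)) {A : Finset (Fin (n + 1))}
    (hA : Fin.last n ∈ A) : coeff (Qpart a) (A.erase (Fin.last n)) = coeff a A := by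
  have h : coeff (Qpart a) (A.erase (Fin.last n)) =
      a (insert (Fin.last n) (A.erase (Fin.last n))) := if_neg (Finset.notMem_erase _ _)
  rw [h, Finset.insert_erase hA]
  rfl

lemma isOpen_upperHalf (n : ℕ) : IsOpen (upperHalf n) :=
  isOpen_lt continuous_const (continuous_apply _)

end Cl

/-- Theorem 2 (in multiplicative form): if `f` satisfies the Weinstein system with
parameter `-m` characterizing `Δ^{(k+2)/2} f = 0` for `k = -m`, then `g = xₙ^m f`
satisfies `Δ^{(m+2)/2} g = 0`. -/
theorem weinstein_scaling
    (d : ℕ) (m : ℕ) (hm : Even m)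
    (f : (Fin (d + 2) → ℝ) → Cl (d + 1))
    (hf : ContDiffOn ℝ (⊤ : ℕ∞) f (Cl.upperHalf (d + 1)))
    (hP : ∀ x ∈ Cl.upperHalf (d + 1),
      Cl.lap (fun y => Cl.Ppart (f y)) x +
        ((m : ℝ) / x (Fin.last (d + 1))) •
          Cl.pderiv (Fin.last (d + 1)) (fun y => Cl.Ppart (f y)) x = 0)
    (hQ : ∀ x ∈ Cl.upperHalf (d + 1),
      Cl.lap (fun y => Cl.Qpart (f y)) x +
        ((m : ℝ) / x (Fin.last (d + 1))) •
          Cl.pderiv (Fin.last (d + 1)) (fun y => Cl.Qpart (f y)) x =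
        ((m : ℝ) / x (Fin.last (d + 1)) ^ 2) • Cl.Qpart (f x))
    (g : (Fin (d + 2) → ℝ) → Cl (d + 1))
    (hg : g = fun y => (y (Fin.last (d + 1)) ^ m) • f y) :
    ∀ x ∈ Cl.upperHalf (d + 1), (Cl.lap)^[(m + 2) / 2] g x = 0 := by
  have hU := Cl.isOpen_upperHalf (d + 1)
  have hi : ∀ x ∈ Cl.upperHalf (d + 1), x (Fin.last (d + 1)) ≠ 0 := fun x hx => ne_of_gt hx
  obtain ⟨p, rfl⟩ := hm
  have hgs : ContDiffOn ℝ (⊤ : ℕ∞) g (Cl.upperHalf (d + 1)) := by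
    rw [hg]
    exact ((Cl.contDiffOn_coord _).pow _).smul hf
  have key (c : ℝ) (hc : c * c = c) (F : (Fin (d + 2) → ℝ) → Cl (d + 1))
      (hF : ContDiffOn ℝ (⊤ : ℕ∞) F (Cl.upperHalf (d + 1)))
      (h : ∀ x ∈ Cl.upperHalf (d + 1), Cl.lap F x +
        (((p + p : ℕ) : ℝ) / x (Fin.last (d + 1))) • Cl.pderiv (Fin.last (d + 1)) F x =
          (c * ((p + p : ℕ) : ℝ) / x (Fin.last (d + 1)) ^ 2) • F x)
      (A B : Finset (Fin (d + 1))) (hFA : ∀ y, Cl.coeff (F y) B = Cl.coeff (f y) A)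
      (x : Fin (d + 2) → ℝ) (hx : x ∈ Cl.upperHalf (d + 1)) :
      Cl.coeff (Cl.lap^[p + 1] g x) A = 0 := by
    have h1 := Cl.iterate_lap_clm_comp hU hgs (Cl.coeffCLM A) (p + 1) hx
    refine Eq.trans h1.symm ?_
    have h2 : (fun y => Cl.coeffCLM A (g y)) =
        fun y => y (Fin.last (d + 1)) ^ (2 * p) * Cl.coeffCLM B (F y) := by
      funext y
      change Cl.coeff (g y) A = y (Fin.last (d + 1)) ^ (2 * p) * Cl.coeff (F y) B
      rw [hFA, hg, two_mul]
      rfl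
    rw [h2]
    refine Cl.iterate_lap_coord_pow_mul_eq_zero hU _ hi hc p
      (u := fun y => Cl.coeffCLM B (F y))
      ((Cl.coeffCLM B).contDiff.comp_contDiffOn hF) (fun z hz => ?_) x hx
    have h3 := congrArg (Cl.coeffCLM B) (h z hz)
    have hz0 := hi z hz
    rw [Cl.lap_clm_comp hU hF (Cl.coeffCLM B) hz, Cl.pderiv_clm_comp hU hF (Cl.coeffCLM B) _ hz]
    simp only [map_add, map_smul, smul_eq_mul] at h3
    push_cast at h3
    field_simp at h3
    linear_combination h3
  intro x hx
  rw [show (p + p + 2) / 2 = p + 1 by lia]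
  funext A
  by_cases hA : Fin.last d ∈ A
  · exact key 1 (by norm_num) (fun y => Cl.Qpart (f y))
      ((Cl.QpartCLM d).contDiff.comp_contDiffOn hf)
      (fun x hx => by simpa only [one_mul] using hQ x hx) A _
      (fun y => Cl.coeff_Qpart_erase (f y) hA) x hx
  · exact key 0 (by norm_num) (fun y => Cl.Ppart (f y))
      ((Cl.PpartCLM d).contDiff.comp_contDiffOn hf)
      (fun x hx => by simpa only [zero_mul, zero_div, zero_smul] using hP x hx) A A
      (fun y => Cl.coeff_Ppart (f y) hA) x hx
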